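/- Let R be a commutative ring and A := R[[t]] the formal power series ring in one variable over R. For a quadruple (f_w, f_x, f_y, f_z) ∈ A⁴ the following are equivalent: (a) t divides each of f_w − f_x, f_x − f_y, f_y − f_z, and t² divides f_w − f_x − f_y + f_z; (b) (f_w, f_x, f_y, f_z) belongs to the A-submodule of A⁴ generated by the four elements (1,1,1,1), (t,t,0,0), (t,0,t,0), and (t²,0,0,0). (This is the algebraic content of the computation of the image of the pullback Ω*_D(𝔽₀)_ℚ → S(D)⁴_ℚ for the quadric surface 𝔽₀ = ℙ¹ × ℙ¹ with its natural torus action, where t plays the role of the first equivariant Chern class c₁^D(L_{−α}).) -/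

import Mathlib

open PowerSeries

/-- Quadric surface case `𝔽₀ = ℙ¹ × ℙ¹`: in `A = R[[t]]`, a quadruple
`(f_w, f_x, f_y, f_z)` satisfies `f_w ≡ f_x ≡ f_y ≡ f_z mod t` and
`f_w − f_x − f_y + f_z ≡ 0 mod t²` iff it lies in the `A`-submodule of `A⁴`
spanned by `(1,1,1,1)`, `(t,t,0,0)`, `(t,0,t,0)` and `(t²,0,0,0)`. -/
theorem statement1 {R : Type*} [CommRing R]
    (fw fx fy fz : PowerSeries R) :
    ((X : PowerSeries R) ∣ fw - fx ∧ (X : PowerSeries R) ∣ fx - fy ∧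
        (X : PowerSeries R) ∣ fy - fz ∧ (X : PowerSeries R) ^ 2 ∣ fw - fx - fy + fz) ↔
      (fw, fx, fy, fz) ∈ Submodule.span (PowerSeries R)
        ({(1, 1, 1, 1), (X, X, 0, 0), (X, 0, X, 0), (X ^ 2, 0, 0, 0)} :
          Set (PowerSeries R × PowerSeries R × PowerSeries R × PowerSeries R)) := by
  simp only [Submodule.mem_span_insert, Submodule.mem_span_singleton]
  constructor
  · rintro ⟨-, ⟨b, hb⟩, ⟨c, hc⟩, ⟨d, hd⟩⟩
    refine ⟨fz, _, ⟨b + c, _, ⟨c, _, ⟨d, rfl⟩, rfl⟩, rfl⟩, ?_⟩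
    simp only [Prod.smul_mk, Prod.mk_add_mk, smul_eq_mul, Prod.mk.injEq]
    refine ⟨?_, ?_, ?_, ?_⟩
    · linear_combination hd + hb + 2 * hc
    · linear_combination hb + hc
    · linear_combination hc
    · ring
  · rintro ⟨a, _, ⟨b, _, ⟨c, _, ⟨d, rfl⟩, rfl⟩, rfl⟩, h⟩
    simp only [Prod.smul_mk, Prod.mk_add_mk, smul_eq_mul, Prod.mk.injEq] at h
    obtain ⟨rfl, rfl, rfl, rfl⟩ := h
    exact ⟨⟨c + X * d, by ring⟩, ⟨b - c, by ring⟩, ⟨c, by ring⟩, ⟨d, by ring⟩⟩
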